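/- For every continuous basic cover S, the Lawson topology L(S) is naturally isomorphic to Patch(Lower(S)), the patch of the lower powerlocale of S; the isomorphism is given by the unique formal topology map over S comparing the coreflection map ε_L : L(S) → S with σ_L : Lower(S) → S. -/

import Mathlib

noncomputable section
open Classical

universe u v

namespace FTP

/-! ### Basic covers -/

/-- `U ◁ V` : every element of `U` is covered by `V`. -/
def covS {S : Type*} (cov : S → Set S → Prop) (U V : Set S) : Prop :=
  ∀ a ∈ U, cov a V

/-- A basic cover: reflexivity and transitivity. -/
def IsBasicCover {S : Type*} (cov : S → Set S → Prop) : Prop :=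
  (∀ (a : S) (U : Set S), a ∈ U → cov a U) ∧
  (∀ (a : S) (U V : Set S), cov a U → covS cov U V → cov a V)

/-- the way-below relation `a ≪ b`. -/
def wb {S : Type*} (cov : S → Set S → Prop) (a b : S) : Prop :=
  ∀ U : Set S, cov b U → ∃ U₀ : Finset S, ↑U₀ ⊆ U ∧ cov a ↑U₀

/-- the way-below relation between subsets `U ≪ V`. -/
def wbS {S : Type*} (cov : S → Set S → Prop) (U V : Set S) : Prop :=
  ∀ W : Set S, covS cov V W → ∃ W₀ : Finset S, ↑W₀ ⊆ W ∧ covS cov U ↑W₀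

/-- A continuous basic cover, with the witnessing function `w`. -/
def IsContinuous {S : Type*} (cov : S → Set S → Prop) (w : S → Set S) : Prop :=
  (∀ a : S, ∀ b ∈ w a, wb cov b a) ∧ (∀ a : S, cov a (w a))

/-- splitting subsets. -/
def Splitting {S : Type*} (cov : S → Set S → Prop) (V : Set S) : Prop :=
  ∀ (a : S) (U : Set S), a ∈ V → cov a U → (V ∩ U).Nonempty

/-- located subsets. -/
def Located {S : Type*} (cov : S → Set S → Prop) (V : Set S) : Prop :=
  Splitting cov V ∧ ∀ a b : S, wb cov a b → a ∉ V ∨ b ∈ V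

/-- inverse image of a relation. -/
def rinv {α β : Type*} (r : α → β → Prop) (U : Set β) : Set α :=
  {x | ∃ a ∈ U, r x a}

/-- basic cover maps. -/
def IsBCM {α β : Type*} (cov : α → Set α → Prop) (cov' : β → Set β → Prop)
    (r : α → β → Prop) : Prop :=
  ∀ (a : β) (U : Set β), cov' a U → covS cov (rinv r {a}) (rinv r U)

/-- perfect maps. -/
def IsPerfect {α β : Type*} (cov : α → Set α → Prop) (cov' : β → Set β → Prop)
    (r : α → β → Prop) : Prop :=
  ∀ a b : β, wb cov' a b → wbS cov (rinv r {a}) (rinv r {b})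

/-- the terminal basic cover `1 = ({∗}, ∈)`. -/
def unitCov : Unit → Set Unit → Prop := fun x U => x ∈ U

/-! ### Formal topologies -/

/-- `U ↓ V` with respect to a preorder `le`. -/
def down {S : Type*} (le : S → S → Prop) (U V : Set S) : Set S :=
  {c | ∃ a ∈ U, ∃ b ∈ V, le c a ∧ le c b}

/-- A formal topology: a basic cover together with a compatible preorder. -/
def IsFormalTopology {S : Type*} (cov : S → Set S → Prop) (le : S → S → Prop) : Prop :=
  IsBasicCover cov ∧ Reflexive le ∧ Transitive le ∧
  (∀ a b : S, le a b → cov a {b}) ∧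
  (∀ (a : S) (U V : Set S), cov a U → cov a V → cov a (down le U V))

/-- formal topology maps. -/
def IsFTM {α β : Type*} (cov : α → Set α → Prop) (le : α → α → Prop)
    (cov' : β → Set β → Prop) (le' : β → β → Prop) (r : α → β → Prop) : Prop :=
  IsBCM cov cov' r ∧
  covS cov Set.univ (rinv r Set.univ) ∧
  ∀ a b : β, covS cov (down le (rinv r {a}) (rinv r {b})) (rinv r (down le' {a} {b}))

/-- the order on maps. -/
def MapLE {α β : Type*} (cov : α → Set α → Prop) (r s : α → β → Prop) : Prop :=
  ∀ a : β, covS cov (rinv r {a}) (rinv s {a})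

/-- equality of maps. -/
def MapEq {α β : Type*} (cov : α → Set α → Prop) (r s : α → β → Prop) : Prop :=
  MapLE cov r s ∧ MapLE cov s r

/-- composition of relational maps (`comp s r = s ∘ r`). -/
def comp {α β γ : Type*} (s : β → γ → Prop) (r : α → β → Prop) : α → γ → Prop :=
  fun x c => ∃ b, r x b ∧ s b c

/-- `b* = {c | c ↓ b ◁ ∅}`. -/
def star {S : Type*} (cov : S → Set S → Prop) (le : S → S → Prop) (b : S) : Set S :=
  {c | covS cov (down le {c} {b}) ∅}

/-- `b ⋘ a` iff `S ◁ b* ∪ {a}`. -/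
def wc {S : Type*} (cov : S → Set S → Prop) (le : S → S → Prop) (b a : S) : Prop :=
  covS cov Set.univ (star cov le b ∪ {a})

/-- regular formal topologies. -/
def Regular {S : Type*} (cov : S → Set S → Prop) (le : S → S → Prop) : Prop :=
  ∀ a : S, cov a {b | wc cov le b a}

/-- compactness: `S ≪ S`. -/
def Compact {S : Type*} (cov : S → Set S → Prop) : Prop :=
  wbS cov Set.univ Set.univ

/-- stability: `a ≪ a'` and `b ≪ b'` imply `a↓b ≪ a'↓b'`. -/
def Stable {S : Type*} (cov : S → Set S → Prop) (le : S → S → Prop) : Prop :=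
  ∀ a a' b b' : S, wb cov a a' → wb cov b b' →
    wbS cov (down le {a} {b}) (down le {a'} {b'})

/-- isomorphism of formal topologies. -/
def IsIso {α β : Type*} (cov : α → Set α → Prop) (le : α → α → Prop)
    (cov' : β → Set β → Prop) (le' : β → β → Prop) : Prop :=
  ∃ (r : α → β → Prop) (s : β → α → Prop),
    IsFTM cov le cov' le' r ∧ IsFTM cov' le' cov le s ∧
    MapEq cov (comp s r) (fun a b => a = b) ∧
    MapEq cov' (comp r s) (fun a b => a = b)

/-! ### Geometric theories and the covers they present -/

/-- the preorder `A ≤ B ↔ B ⊆ A` on finite sets of generators. -/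
def supord {P : Type*} : Finset P → Finset P → Prop := fun A B => B ⊆ A

/-- The cover on `Finset P` inductively generated by a geometric theory `T`
(an axiom `T A 𝒞` means `⋀A ⊢ ⋁_{B ∈ 𝒞} ⋀B`). -/
inductive GCov {P : Type*} (T : Finset P → Set (Finset P) → Prop) :
    Finset P → Set (Finset P) → Prop where
  | refl {A : Finset P} {𝒰 : Set (Finset P)} : A ∈ 𝒰 → GCov T A 𝒰
  | le {A B : Finset P} {𝒰 : Set (Finset P)} : B ⊆ A → GCov T B 𝒰 → GCov T A 𝒰
  | ax {A : Finset P} {𝒞 𝒰 : Set (Finset P)} (C : Finset P) :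
      T A 𝒞 → (∀ B ∈ 𝒞, GCov T (C ∪ B) 𝒰) → GCov T (C ∪ A) 𝒰

theorem GCov_trans {P : Type*} {T : Finset P → Set (Finset P) → Prop}
    {A : Finset P} {𝒰 𝒱 : Set (Finset P)}
    (h : GCov T A 𝒰) (h' : ∀ B ∈ 𝒰, GCov T B 𝒱) : GCov T A 𝒱 := by
  induction h with
  | refl hA => exact h' _ hA
  | le hBA _ ih => exact GCov.le hBA (ih h')
  | ax C hT _ ih => exact GCov.ax C hT (fun B hB => ih B hB h')

theorem GCov_isBasicCover {P : Type*} (T : Finset P → Set (Finset P) → Prop) :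
    IsBasicCover (GCov T) :=
  ⟨fun _ _ h => GCov.refl h, fun _ _ _ h h' => GCov_trans h h'⟩

/-! ### The patch, Lawson and lower powerlocale theories -/

/-- generators of the patch/Lawson theories : `r a` and `l A`. -/
inductive PatchGen (S : Type u) : Type u where
  | r : S → PatchGen S
  | l : Finset S → PatchGen S

/-- The geometric theory `T_P` presenting the patch of a stably locally compact
formal topology. -/
inductive PatchThy {S : Type*} (cov : S → Set S → Prop) (le : S → S → Prop) :
    Finset (PatchGen S) → Set (Finset (PatchGen S)) → Prop where
  | R1 : PatchThy cov le ∅ {B | ∃ a : S, B = {PatchGen.r a}}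
  | R2 (a b : S) :
      PatchThy cov le {PatchGen.r a, PatchGen.r b}
        {B | ∃ c ∈ down le {a} {b}, B = {PatchGen.r c}}
  | R3 (a : S) (A : Finset S) :
      cov a ↑A → PatchThy cov le {PatchGen.r a} {B | ∃ b ∈ A, B = {PatchGen.r b}}
  | R4 (a : S) :
      PatchThy cov le {PatchGen.r a} {B | ∃ b : S, wb cov b a ∧ B = {PatchGen.r b}}
  | L1 : PatchThy cov le ∅ {({PatchGen.l ∅} : Finset (PatchGen S))}
  | L2 (A B : Finset S) :
      covS cov ↑A ↑B →
      PatchThy cov le {PatchGen.l B} {({PatchGen.l A} : Finset (PatchGen S))}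
  | L3 (A B : Finset S) :
      PatchThy cov le {PatchGen.l A, PatchGen.l B}
        {D | ∃ C : Finset S, wbS cov ↑A ↑C ∧ wbS cov ↑B ↑C ∧ D = {PatchGen.l C}}
  | Loc (a b : S) :
      wb cov a b →
      PatchThy cov le ∅
        {({PatchGen.l {a}} : Finset (PatchGen S)), ({PatchGen.r b} : Finset (PatchGen S))}
  | D (a : S) :
      PatchThy cov le {PatchGen.l {a}, PatchGen.r a} (∅ : Set (Finset (PatchGen S)))

/-- the cover of `Patch(S)`. -/
def patchCov {S : Type*} (cov : S → Set S → Prop) (le : S → S → Prop) :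
    Finset (PatchGen S) → Set (Finset (PatchGen S)) → Prop :=
  GCov (PatchThy cov le)

/-- the counit `ε_P : Patch(S) → S`. -/
def epsP {S : Type*} (cov : S → Set S → Prop) (le : S → S → Prop) :
    Finset (PatchGen S) → S → Prop :=
  fun 𝔄 a => patchCov cov le 𝔄 {({PatchGen.r a} : Finset (PatchGen S))}

/-- The geometric theory `T_L` presenting the Lawson topology of a continuous
basic cover (the axioms of `T_P` without (R1), (R2)). -/
inductive LawsonThy {S : Type*} (cov : S → Set S → Prop) :
    Finset (PatchGen S) → Set (Finset (PatchGen S)) → Prop where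
  | R3 (a : S) (A : Finset S) :
      cov a ↑A → LawsonThy cov {PatchGen.r a} {B | ∃ b ∈ A, B = {PatchGen.r b}}
  | R4 (a : S) :
      LawsonThy cov {PatchGen.r a} {B | ∃ b : S, wb cov b a ∧ B = {PatchGen.r b}}
  | L1 : LawsonThy cov ∅ {({PatchGen.l ∅} : Finset (PatchGen S))}
  | L2 (A B : Finset S) :
      covS cov ↑A ↑B →
      LawsonThy cov {PatchGen.l B} {({PatchGen.l A} : Finset (PatchGen S))}
  | L3 (A B : Finset S) :
      LawsonThy cov {PatchGen.l A, PatchGen.l B}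
        {D | ∃ C : Finset S, wbS cov ↑A ↑C ∧ wbS cov ↑B ↑C ∧ D = {PatchGen.l C}}
  | Loc (a b : S) :
      wb cov a b →
      LawsonThy cov ∅
        {({PatchGen.l {a}} : Finset (PatchGen S)), ({PatchGen.r b} : Finset (PatchGen S))}
  | D (a : S) :
      LawsonThy cov {PatchGen.l {a}, PatchGen.r a} (∅ : Set (Finset (PatchGen S)))

/-- the cover of the Lawson topology `L(S)`. -/
def lawsonCov {S : Type*} (cov : S → Set S → Prop) :
    Finset (PatchGen S) → Set (Finset (PatchGen S)) → Prop :=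
  GCov (LawsonThy cov)

/-- the counit `ε_L : L(S) → S`. -/
def epsL {S : Type*} (cov : S → Set S → Prop) : Finset (PatchGen S) → S → Prop :=
  fun 𝔄 a => lawsonCov cov 𝔄 {({PatchGen.r a} : Finset (PatchGen S))}

/-- The theory presenting the lower powerlocale of a continuous basic cover:
generators `a ∈ S`, axioms (R3) and (R4). -/
inductive LowerThy {S : Type*} (cov : S → Set S → Prop) :
    Finset S → Set (Finset S) → Prop where
  | R3 (a : S) (A : Finset S) :
      cov a ↑A → LowerThy cov {a} {B | ∃ b ∈ A, B = ({b} : Finset S)}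
  | R4 (a : S) :
      LowerThy cov {a} {B | ∃ b : S, wb cov b a ∧ B = ({b} : Finset S)}

/-- the cover of the lower powerlocale `Lower(S)`. -/
def lowerCov {S : Type*} (cov : S → Set S → Prop) :
    Finset S → Set (Finset S) → Prop :=
  GCov (LowerThy cov)

/-- the counit `σ_L : Lower(S) → S`. -/
def sigmaL {S : Type*} (cov : S → Set S → Prop) : Finset S → S → Prop :=
  fun A a => lowerCov cov A ({({a} : Finset S)} : Set (Finset S))

/-! ### de Groot duals -/

/-- `↟A = {B ∈ Fin S | A ≪ B}`. -/
def upF {S : Type*} (cov : S → Set S → Prop) (A : Finset S) : Set (Finset S) :=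
  {B | wbS cov ↑A ↑B}

/-- the finite join `⋁^F {↟A | A ∈ 𝒜}` of Scott open filters. -/
def finJoin {S : Type*} (cov : S → Set S → Prop) (le : S → S → Prop)
    (𝒜 : Finset (Finset S)) : Set (Finset S) :=
  if 𝒜 = ∅ then {B | covS cov Set.univ ↑B}
  else {B | ∃ g : Finset S → Finset S,
    (∀ A ∈ 𝒜, wbS cov ↑A ↑(g A)) ∧
    wbS cov {c | ∀ A ∈ 𝒜, ∃ b ∈ g A, le c b} ↑B}

/-- The cover `◁^D` of the de Groot dual `S^D`, inductively generated on
`(Fin S, ⊇)` by the axioms (D3) `A ◁ ↟A` and (D4). -/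
inductive DCov {S : Type*} (cov : S → Set S → Prop) (le : S → S → Prop) :
    Finset S → Set (Finset S) → Prop where
  | refl {A : Finset S} {𝒰 : Set (Finset S)} : A ∈ 𝒰 → DCov cov le A 𝒰
  | le {A B : Finset S} {𝒰 : Set (Finset S)} :
      B ⊆ A → DCov cov le B 𝒰 → DCov cov le A 𝒰
  | d3 {A A' : Finset S} {𝒰 : Set (Finset S)} :
      A ⊆ A' →
      (∀ C : Finset S, A' ⊆ C → (∃ B : Finset S, wbS cov ↑A ↑B ∧ B ⊆ C) →
        DCov cov le C 𝒰) →
      DCov cov le A' 𝒰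
  | d4 {A A' : Finset S} {𝒜 : Finset (Finset S)} {𝒰 : Set (Finset S)} :
      A ⊆ A' → upF cov A ⊆ finJoin cov le 𝒜 →
      (∀ C : Finset S, A' ⊆ C → (∃ B ∈ 𝒜, B ⊆ C) → DCov cov le C 𝒰) →
      DCov cov le A' 𝒰

/-- the cover of the Scott topology `Σ(S)` on `(Fin S, ⊇)`. -/
def scottCov {S : Type*} (cov : S → Set S → Prop) :
    Finset S → Set (Finset S) → Prop :=
  fun A 𝒰 => upF cov A ⊆ ⋃ B ∈ 𝒰, upF cov B

/-- a filter (with respect to `◁`) of basic opens, given by a set of finite subsets. -/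
def IsCovFilter {S : Type*} (cov : S → Set S → Prop) (le : S → S → Prop)
    (𝒱 : Set (Finset S)) : Prop :=
  𝒱.Nonempty ∧
  (∀ A ∈ 𝒱, ∀ B : Finset S, covS cov ↑A ↑B → B ∈ 𝒱) ∧
  (∀ A ∈ 𝒱, ∀ B ∈ 𝒱, ∃ C ∈ 𝒱, covS cov ↑C (down le ↑A ↑B))

/-- The geometric theory `T^d` presenting the de Groot dual `S^d`:
generators `l A` (identified with `A : Finset S`), axioms (L1)–(L3) and (D4). -/
inductive DGThy {S : Type*} (cov : S → Set S → Prop) (le : S → S → Prop) :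
    Finset (Finset S) → Set (Finset (Finset S)) → Prop where
  | L1 : DGThy cov le ∅ {({(∅ : Finset S)} : Finset (Finset S))}
  | L2 (A B : Finset S) :
      covS cov ↑A ↑B → DGThy cov le {B} {({A} : Finset (Finset S))}
  | L3 (A B : Finset S) :
      DGThy cov le {A, B}
        {D | ∃ C : Finset S, wbS cov ↑A ↑C ∧ wbS cov ↑B ↑C ∧ D = ({C} : Finset (Finset S))}
  | D4 (A : Finset S) (𝒜 : Finset (Finset S)) :
      upF cov A ⊆ finJoin cov le 𝒜 →
      DGThy cov le {A} {D | ∃ B ∈ 𝒜, D = ({B} : Finset (Finset S))}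

/-! ### Spectral formal topologies -/

/-- spectral formal topologies: a compatible meet-semilattice structure on the
base, with every basic element way-below itself. -/
def IsSpectral {S : Type*} (cov : S → Set S → Prop) (le : S → S → Prop)
    (one : S) (meet : S → S → S) : Prop :=
  (∀ a : S, cov a {one}) ∧
  (∀ a b : S, cov (meet a b) (down le {a} {b})) ∧
  (∀ a b : S, ∀ c ∈ down le {a} {b}, cov c {meet a b}) ∧
  (∀ a : S, wb cov a a)

/-! ### Subtopologies -/

/-- the property of being a formal-topology cover compatible with `le`. -/
def IsFTCover {S : Type*} (cov : S → Set S → Prop) (le : S → S → Prop) : Prop :=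
  IsBasicCover cov ∧ (∀ a b : S, le a b → cov a {b}) ∧
  (∀ (a : S) (U V : Set S), cov a U → cov a V → cov a (down le U V))

/-- The meet (in `SubTop(S)`) of a family of subtopology covers: the least
formal-topology cover containing all of them. -/
def covMeet {S : Type*} {ι : Sort*} (le : S → S → Prop)
    (F : ι → (S → Set S → Prop)) : S → Set S → Prop :=
  fun a U => ∀ c : S → Set S → Prop,
    IsFTCover c le → (∀ i : ι, ∀ (a' : S) (U' : Set S), F i a' U' → c a' U') → c a U

/-- the closed subtopology `C_a` determined by `{a}`. -/
def closedCov {S : Type*} (cov : S → Set S → Prop) (a : S) : S → Set S → Prop :=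
  fun c V => cov c ({a} ∪ V)

/-- the open subtopology `S_B` determined by a finite `B`. -/
def openCov {S : Type*} (cov : S → Set S → Prop) (le : S → S → Prop)
    (B : Finset S) : S → Set S → Prop :=
  fun c V => covS cov (down le {c} ↑B) V

/-- `K_A = ⋀_{A ≪ B} S_B`. -/
def KCov {S : Type*} (cov : S → Set S → Prop) (le : S → S → Prop) (A : Finset S) :
    S → Set S → Prop :=
  covMeet le (fun B : {B : Finset S // wbS cov ↑A ↑B} => openCov cov le B.1)

/-- `C_a ∨ K_A` (the join of subtopologies is the intersection of covers). -/
def CKCov {S : Type*} (cov : S → Set S → Prop) (le : S → S → Prop)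
    (a : S) (A : Finset S) : S → Set S → Prop :=
  fun c V => closedCov cov a c V ∧ KCov cov le A c V

/-- perfect subtopologies. -/
def IsPerfectSub {S : Type*} (cov : S → Set S → Prop) (le : S → S → Prop)
    (cov' : S → Set S → Prop) : Prop :=
  IsFTCover cov' le ∧ (∀ (a : S) (U : Set S), cov a U → cov' a U) ∧
  (∀ a b : S, wb cov a b → wb cov' a b)

/-- the order of `PSub(S)`: `(a,A) ≤ (b,B)` iff `C_b ∨ K_B ⊑ C_a ∨ K_A`. -/
def PSubLe {S : Type*} (cov : S → Set S → Prop) (le : S → S → Prop) :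
    S × Finset S → S × Finset S → Prop :=
  fun p q => ∀ (c : S) (V : Set S), CKCov cov le p.1 p.2 c V → CKCov cov le q.1 q.2 c V

/-- the cover of `PSub(S)`: `(a,A) ◁ U` iff `⋀{C_b ∨ K_B | (b,B) ∈ U} ⊑ C_a ∨ K_A`. -/
def covPSub {S : Type*} (cov : S → Set S → Prop) (le : S → S → Prop) :
    S × Finset S → Set (S × Finset S) → Prop :=
  fun p U => ∀ (c : S) (V : Set S), CKCov cov le p.1 p.2 c V →
    covMeet le (fun q : U => CKCov cov le q.1.1 q.1.2) c V

/-- the map `r : PSub(S) → Patch(S)` on generators. -/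
def rGenPS {S : Type*} (cov : S → Set S → Prop) (le : S → S → Prop)
    (p : S × Finset S) : PatchGen S → Prop
  | PatchGen.r b => covPSub cov le p {((b, (∅ : Finset S)) : S × Finset S)}
  | PatchGen.l B => covPSub cov le p {q : S × Finset S | q.2 = B}

/-- the map `r : PSub(S) → Patch(S)`, extended along the presentation. -/
def rPS {S : Type*} (cov : S → Set S → Prop) (le : S → S → Prop) :
    S × Finset S → Finset (PatchGen S) → Prop :=
  fun p 𝔅 => ∀ g ∈ 𝔅, covPSub cov le p (rinv (fun q g' => rGenPS cov le q g') {g})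

/-- the map `s : Patch(S) → PSub(S)`. -/
def sPS {S : Type*} (cov : S → Set S → Prop) (le : S → S → Prop) :
    Finset (PatchGen S) → (S × Finset S) → Prop :=
  fun 𝔄 p => patchCov cov le 𝔄
    ({({PatchGen.r p.1, PatchGen.l p.2} : Finset (PatchGen S))} : Set (Finset (PatchGen S)))

/-! ### Saturated subsets, dcpos and preframes -/

/-- the saturated subsets of a basic cover. -/
abbrev SatSet {α : Type*} (cov : α → Set α → Prop) : Type _ :=
  {U : Set α // ∀ a, cov a U → a ∈ U}

/-- the join of a family of saturated subsets. -/
def satSup {α : Type*} {cov : α → Set α → Prop} (hbc : IsBasicCover cov)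
    (D : Set (SatSet cov)) : SatSet cov :=
  ⟨{a | cov a (⋃ U ∈ D, (U : Set α))}, fun a h => hbc.2 a _ _ h (fun _ hb => hb)⟩

/-- inductively generated basic covers: `BGen Ax` is the cover generated by the
axiom-set with axioms `a ◁ C` for `C ∈ Ax a`. -/
inductive BGen {S : Type*} (Ax : S → Set (Set S)) : S → Set S → Prop where
  | refl {a : S} {U : Set S} : a ∈ U → BGen Ax a U
  | infty {a : S} {U : Set S} (C : Set S) :
      C ∈ Ax a → (∀ b ∈ C, BGen Ax b U) → BGen Ax a U

theorem BGen_trans {S : Type*} {Ax : S → Set (Set S)} {a : S} {U V : Set S}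
    (h : BGen Ax a U) (h' : ∀ b ∈ U, BGen Ax b V) : BGen Ax a V := by
  induction h with
  | refl ha => exact h' _ ha
  | infty C hC _ ih => exact BGen.infty C hC (fun b hb => ih b hb h')

theorem BGen_isBasicCover {S : Type*} (Ax : S → Set (Set S)) :
    IsBasicCover (BGen Ax) :=
  ⟨fun _ _ h => BGen.refl h, fun _ _ _ h h' => BGen_trans h h'⟩

/-- the lower powerlocale theory of an inductively generated basic cover. -/
inductive LowerThyAx {S : Type*} (Ax : S → Set (Set S)) :
    Finset S → Set (Finset S) → Prop where
  | mk (a : S) (C : Set S) :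
      C ∈ Ax a → LowerThyAx Ax {a} {B | ∃ b ∈ C, B = ({b} : Finset S)}

/-- the counit `σ_L : Lower(S) → S` for an inductively generated basic cover. -/
def sigmaLAx {S : Type*} (Ax : S → Set (Set S)) : Finset S → S → Prop :=
  fun A a => GCov (LowerThyAx Ax) A ({({a} : Finset S)} : Set (Finset S))

/-- the top saturated subset of a presented topology. -/
def satTop {P : Type*} (T : Finset P → Set (Finset P) → Prop) : SatSet (GCov T) :=
  ⟨Set.univ, fun _ _ => Set.mem_univ _⟩

/-- binary meets of saturated subsets of a presented topology. -/
def satInfL {P : Type*} (T : Finset P → Set (Finset P) → Prop)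
    (U V : SatSet (GCov T)) : SatSet (GCov T) :=
  ⟨{A | GCov T A (down supord (U : Set (Finset P)) (V : Set (Finset P)))},
   fun _ h => GCov_trans h (fun _ hB => hB)⟩

/-- the suplattice homomorphism `σ_L* : Sat(S) → Sat(Lower(S))`. -/
def sigmaStar {S : Type*} (Ax : S → Set (Set S)) (U : SatSet (BGen Ax)) :
    SatSet (GCov (LowerThyAx Ax)) :=
  ⟨{A : Finset S | GCov (LowerThyAx Ax) A (rinv (sigmaLAx Ax) (U : Set S))},
   fun _ h => GCov_trans h (fun _ hB => hB)⟩

/-- a preframe structure on a partial order: finite meets and directed joins,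
with finite meets distributing over directed joins. -/
structure PreframeStr (X : Type*) [PartialOrder X] where
  top : X
  inf : X → X → X
  dSup : Set X → X
  le_top : ∀ x, x ≤ top
  inf_le_left : ∀ x y, inf x y ≤ x
  inf_le_right : ∀ x y, inf x y ≤ y
  le_inf : ∀ x y z, x ≤ y → x ≤ z → x ≤ inf y z
  le_dSup : ∀ d : Set X, d.Nonempty → DirectedOn (· ≤ ·) d → ∀ x ∈ d, x ≤ dSup d
  dSup_le : ∀ d : Set X, d.Nonempty → DirectedOn (· ≤ ·) d →
    ∀ z, (∀ x ∈ d, x ≤ z) → dSup d ≤ z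
  distrib : ∀ (x : X) (d : Set X), d.Nonempty → DirectedOn (· ≤ ·) d →
    inf x (dSup d) = dSup ((fun y => inf x y) '' d)

/-- dcpo homomorphisms out of `Sat(S)`. -/
def IsDcpoHom {α : Type*} {cov : α → Set α → Prop} (hbc : IsBasicCover cov)
    {X : Type*} [PartialOrder X] (PF : PreframeStr X) (f : SatSet cov → X) : Prop :=
  Monotone f ∧
  ∀ D : Set (SatSet cov), D.Nonempty → DirectedOn (· ≤ ·) D →
    f (satSup hbc D) = PF.dSup (f '' D)

/-- preframe homomorphisms out of the frame of a presented topology. -/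
def IsPreframeHomL {P : Type*} (T : Finset P → Set (Finset P) → Prop)
    {X : Type*} [PartialOrder X] (PF : PreframeStr X)
    (F : SatSet (GCov T) → X) : Prop :=
  Monotone F ∧ F (satTop T) = PF.top ∧
  (∀ U V, F (satInfL T U V) = PF.inf (F U) (F V)) ∧
  ∀ D : Set (SatSet (GCov T)), D.Nonempty → DirectedOn (· ≤ ·) D →
    F (satSup (GCov_isBasicCover T) D) = PF.dSup (F '' D)

/-! ### Located subsets: auxiliary notions -/

/-- the lower part `L_V` associated to a located subset `V`. -/
def LV {S : Type*} (cov : S → Set S → Prop) (V : Set S) : Set S :=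
  {a | ∃ A : Finset S, wbS cov {a} ↑A ∧ (↑A ∩ V : Set S) = ∅}

/-- cuts of a continuous basic cover. -/
def IsCut {S : Type*} (cov : S → Set S → Prop) (L U : Set S) : Prop :=
  (∀ (a : S) (A : Finset S), cov a ↑A → a ∈ U → ((↑A : Set S) ∩ U).Nonempty) ∧
  (∀ a ∈ U, ∃ b : S, wb cov b a ∧ b ∈ U) ∧
  (∀ (a : S) (A : Finset S), cov a ↑A → (↑A : Set S) ⊆ L → a ∈ L) ∧
  (∀ a ∈ L, ∃ A : Finset S, wbS cov {a} ↑A ∧ (↑A : Set S) ⊆ L) ∧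
  (∀ a b : S, wb cov a b → a ∈ L ∨ b ∈ U) ∧
  L ∩ U = ∅

end FTP

namespace FTP

section Presentation

variable {P Q : Type*} {T : Finset P → Set (Finset P) → Prop}
  {T' : Finset Q → Set (Finset Q) → Prop}

theorem GCov.mono {A : Finset P} {𝒰 𝒱 : Set (Finset P)} (h : GCov T A 𝒰) (h' : 𝒰 ⊆ 𝒱) :
    GCov T A 𝒱 :=
  GCov_trans h fun _ hB => GCov.refl (h' hB)

theorem GCov.of_subset {A B : Finset P} {𝒰 : Set (Finset P)} (hB : B ∈ 𝒰) (h : B ⊆ A) :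
    GCov T A 𝒰 :=
  GCov.le h (GCov.refl hB)

/-- The cut rule: a cover of part of the context may be used to split it into cases. -/
theorem GCov.cut {A X : Finset P} {𝒰 𝒱 : Set (Finset P)} (h : GCov T A 𝒱) (hX : A ⊆ X)
    (h' : ∀ B ∈ 𝒱, GCov T (X ∪ B) 𝒰) : GCov T X 𝒰 := by
  induction h generalizing X with
  | refl hA => simpa [Finset.union_eq_left.2 hX] using h' _ hA
  | le hBA _ ih => exact ih (hBA.trans hX) h'
  | @ax A 𝒞 𝒱 C hT _ ih =>
    have hAX : X ∪ A = X := Finset.union_eq_left.2 (Finset.union_subset_right hX)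
    rw [← hAX]
    refine GCov.ax X hT fun B hB => ih B hB ?_ fun D hD => GCov.le ?_ (h' D hD)
    · exact Finset.union_subset_union_left (Finset.union_subset_left hX)
    · exact Finset.union_subset_union_left Finset.subset_union_left

theorem GCov.of_ax {A : Finset P} {𝒞 : Set (Finset P)} (h : T A 𝒞) : GCov T A 𝒞 := by
  simpa using GCov.ax (𝒰 := 𝒞) A h fun B hB => GCov.of_subset hB Finset.subset_union_right

theorem GCov.mono_theory {T₂ : Finset P → Set (Finset P) → Prop}
    (hT : ∀ A 𝒞, T A 𝒞 → T₂ A 𝒞) {A : Finset P} {𝒰 : Set (Finset P)} (h : GCov T A 𝒰) :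
    GCov T₂ A 𝒰 := by
  induction h with
  | refl hA => exact GCov.refl hA
  | le hBA _ ih => exact GCov.le hBA ih
  | ax C h _ ih => exact GCov.ax C (hT _ _ h) ih

/-- A renaming of generators that respects the axioms respects the covers. -/
theorem GCov.image {f : P → Q}
    (hf : ∀ A 𝒞, T A 𝒞 → GCov T' (A.image f) {Y | ∃ B ∈ 𝒞, Y = B.image f})
    {A : Finset P} {𝒰 : Set (Finset P)} (h : GCov T A 𝒰) :
    GCov T' (A.image f) {Y | ∃ B ∈ 𝒰, Y = B.image f} := by
  induction h with
  | refl hA => exact GCov.refl ⟨_, hA, rfl⟩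
  | le hBA _ ih => exact GCov.le (Finset.image_subset_image hBA) ih
  | ax C h _ ih =>
    refine (hf _ _ h).cut (Finset.image_subset_image Finset.subset_union_right) ?_
    rintro _ ⟨B, hB, rfl⟩
    refine GCov.le ?_ (ih B hB)
    rw [Finset.image_union, Finset.image_union]
    exact Finset.union_subset_union_left Finset.subset_union_left

theorem GCov.inter {A : Finset P} {𝒰 𝒱 : Set (Finset P)} (h : GCov T A 𝒰) (h' : GCov T A 𝒱) :
    GCov T A {Y | ∃ B ∈ 𝒰, ∃ C ∈ 𝒱, Y = B ∪ C} := by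
  refine h.cut subset_rfl fun B hB => h'.cut Finset.subset_union_left fun C hC => ?_
  refine GCov.of_subset ⟨B, hB, C, hC, rfl⟩ ?_
  exact Finset.union_subset_union_left Finset.subset_union_right

theorem GCov.singleton_of_forall {X A : Finset P} (h : ∀ g ∈ A, GCov T X {{g}}) :
    GCov T X {A} := by
  induction A using Finset.induction_on with
  | empty => exact GCov.of_subset rfl (Finset.empty_subset _)
  | insert g A _ ih =>
    refine GCov_trans ((h g (Finset.mem_insert_self g A)).inter
      (ih fun x hx => h x (Finset.mem_insert_of_mem hx))) ?_
    rintro _ ⟨_, rfl, _, rfl, rfl⟩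
    exact GCov.refl rfl

/-- The relation induced by interpreting generators of `T` as disjunctions of finite
conjunctions of generators of `T'`. -/
def interp (T' : Finset Q → Set (Finset Q) → Prop) (F : P → Set (Finset Q))
    (X : Finset Q) (A : Finset P) : Prop :=
  ∀ g ∈ A, GCov T' X (F g)

variable {F : P → Set (Finset Q)}

theorem interp.mono {X Y : Finset Q} {A : Finset P} (h : interp T' F X A) (hXY : X ⊆ Y) :
    interp T' F Y A :=
  fun g hg => GCov.le hXY (h g hg)

theorem interp_union {X : Finset Q} {A B : Finset P} (hA : interp T' F X A)
    (hB : interp T' F X B) : interp T' F X (A ∪ B) :=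
  fun g hg => (Finset.mem_union.1 hg).elim (hA g) (hB g)

theorem interp_singleton {X : Finset Q} {g : P} :
    interp T' F X {g} ↔ GCov T' X (F g) := by
  simp [interp]

theorem interp_of_mem {X Y : Finset Q} {g : P} (hY : Y ∈ F g) (h : Y ⊆ X) :
    interp T' F X {g} :=
  interp_singleton.2 (GCov.of_subset hY h)

theorem interp_cov
    (hF : ∀ A 𝒞, T A 𝒞 → ∀ X, interp T' F X A → GCov T' X (rinv (interp T' F) 𝒞))
    {A : Finset P} {𝒰 : Set (Finset P)} (h : GCov T A 𝒰) {X : Finset Q}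
    (hX : interp T' F X A) : GCov T' X (rinv (interp T' F) 𝒰) := by
  induction h generalizing X with
  | refl hA => exact GCov.refl ⟨_, hA, hX⟩
  | le hBA _ ih => exact ih fun g hg => hX g (hBA hg)
  | ax C h _ ih =>
    refine (hF _ _ h X fun g hg => hX g (Finset.mem_union_right _ hg)).cut subset_rfl ?_
    rintro Y ⟨B, hB, hY⟩
    refine ih B hB (interp_union (interp.mono (fun g hg => ?_) Finset.subset_union_left)
      (hY.mono Finset.subset_union_right))
    exact hX g (Finset.mem_union_left _ hg)

theorem interp_isFTM
    (hF : ∀ A 𝒞, T A 𝒞 → ∀ X, interp T' F X A → GCov T' X (rinv (interp T' F) 𝒞)) :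
    IsFTM (GCov T') supord (GCov T) supord (interp T' F) := by
  refine ⟨?_, ?_, ?_⟩
  · rintro A 𝒰 h X ⟨_, rfl, hX⟩
    exact interp_cov hF h hX
  · intro X _
    exact GCov.refl ⟨∅, trivial, fun g hg => absurd hg (Finset.notMem_empty g)⟩
  · rintro A B X ⟨Y, ⟨_, rfl, hY⟩, Z, ⟨_, rfl, hZ⟩, hYX, hZX⟩
    exact GCov.refl ⟨_ ∪ _, ⟨_, rfl, _, rfl, Finset.subset_union_left,
      Finset.subset_union_right⟩, interp_union (hY.mono hYX) (hZ.mono hZX)⟩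

theorem comp_interp_mapEq_id {G : Q → Set (Finset P)}
    (hF : ∀ A 𝒞, T A 𝒞 → ∀ X, interp T' F X A → GCov T' X (rinv (interp T' F) 𝒞))
    (hle : ∀ g, ∀ C ∈ G g, ∀ Y, interp T' F Y C → GCov T' Y {{g}})
    (hge : ∀ g, GCov T' {g} (rinv (interp T' F) (G g))) :
    MapEq (GCov T') (comp (interp T G) (interp T' F)) (fun A B => A = B) := by
  constructor
  · rintro A X ⟨A', hA, B, hXB, hBA⟩
    obtain rfl : A = A' := hA.symm
    have : GCov T' X {A} := by
      refine GCov.singleton_of_forall fun g hg => GCov_trans (interp_cov hF (hBA g hg) hXB) ?_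
      rintro Y ⟨C, hC, hY⟩
      exact hle g C hC Y hY
    exact this.mono (by rintro _ rfl; exact ⟨_, rfl, rfl⟩)
  · rintro A X ⟨A', hA, hX⟩
    obtain rfl : A = X := hA.symm.trans hX.symm
    clear hA hX
    induction A using Finset.induction_on with
    | empty =>
      exact GCov.refl ⟨∅, rfl, ∅, fun g hg => absurd hg (Finset.notMem_empty g),
        fun g hg => absurd hg (Finset.notMem_empty g)⟩
    | insert g A _ ih =>
      refine (hge g).cut (by simp) ?_
      rintro Y ⟨C, hC, hY⟩
      refine ih.cut ((Finset.subset_insert g A).trans Finset.subset_union_left) ?_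
      rintro Z ⟨_, rfl, B, hZ, hB⟩
      refine GCov.refl ⟨_, rfl, C ∪ B, interp_union (hY.mono ?_) (hZ.mono ?_), ?_⟩
      · exact Finset.subset_union_right.trans Finset.subset_union_left
      · exact Finset.subset_union_right
      · rw [Finset.insert_eq]
        exact interp_union (interp_of_mem hC Finset.subset_union_left)
          (hB.mono Finset.subset_union_right)

end Presentation

theorem exists_finset_subset_forall {α β : Type*} {U : Set β} {p : α → Finset β → Prop}
    (hp : ∀ a F F', F ⊆ F' → p a F → p a F') {G : Finset α}
    (h : ∀ a ∈ G, ∃ F : Finset β, ↑F ⊆ U ∧ p a F) :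
    ∃ F : Finset β, ↑F ⊆ U ∧ ∀ a ∈ G, p a F := by
  induction G using Finset.induction_on with
  | empty => exact ⟨∅, by simp, by simp⟩
  | insert a G _ ih =>
    obtain ⟨F₁, h₁, h₁'⟩ := h a (Finset.mem_insert_self a G)
    obtain ⟨F₂, h₂, h₂'⟩ := ih fun x hx => h x (Finset.mem_insert_of_mem hx)
    refine ⟨F₁ ∪ F₂, by simp [h₁, h₂], fun x hx => ?_⟩
    rcases Finset.mem_insert.1 hx with rfl | hx
    · exact hp _ _ _ Finset.subset_union_left h₁'
    · exact hp _ _ _ Finset.subset_union_right (h₂' x hx)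

section Lower

variable {S : Type*} {cov : S → Set S → Prop}

theorem covS_of_wbS (hbc : IsBasicCover cov) {U V : Set S} (h : wbS cov U V) : covS cov U V := by
  obtain ⟨W, hW, hUW⟩ := h V fun a ha => hbc.1 a V ha
  exact fun a ha => hbc.2 _ _ _ (hUW a ha) fun b hb => hbc.1 _ _ (hW hb)

theorem cov_of_wb (hbc : IsBasicCover cov) {a b : S} (h : wb cov a b) : cov a {b} := by
  obtain ⟨U, hU, haU⟩ := h {b} (hbc.1 b _ rfl)
  exact hbc.2 _ _ _ haU fun c hc => hbc.1 _ _ (hU hc)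

theorem exists_finset_cov_wb (hbc : IsBasicCover cov) {w : S → Set S} (hw : IsContinuous cov w)
    {U V : Set S} (h : wbS cov U V) :
    ∃ G : Finset S, covS cov U ↑G ∧ ∀ g ∈ G, ∃ v ∈ V, wb cov g v := by
  obtain ⟨G, hG, hUG⟩ := h {g | ∃ v ∈ V, wb cov g v} fun v hv =>
    hbc.2 _ _ _ (hw.2 v) fun b hb => hbc.1 _ _ ⟨v, hv, hw.1 v b hb⟩
  exact ⟨G, hUG, fun g hg => hG hg⟩

/-- The finite set of singletons of elements of `A`. -/
def sgl (A : Finset S) : Finset (Finset S) :=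
  A.map ⟨fun a => {a}, Finset.singleton_injective⟩

theorem mem_sgl {A : Finset S} {B : Finset S} : B ∈ sgl A ↔ ∃ a ∈ A, B = {a} := by
  simp [sgl, eq_comm]

theorem coe_sgl (A : Finset S) :
    (↑(sgl A) : Set (Finset S)) = {B | ∃ a ∈ (A : Set S), B = {a}} := by
  ext B
  simp [mem_sgl]

/-- Every element of `B` has an element of `A` way below it. -/
def Below (cov : S → Set S → Prop) (A B : Finset S) : Prop :=
  ∀ b ∈ B, ∃ a ∈ A, wb cov a b

theorem lowerCov_of_cov {a : S} {U : Set S} (h : cov a U) :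
    lowerCov cov {a} {B | ∃ b ∈ U, B = {b}} := by
  refine GCov_trans (GCov.of_ax (LowerThy.R4 a)) ?_
  rintro _ ⟨b, hb, rfl⟩
  obtain ⟨U₀, hU₀, hbU⟩ := hb U h
  refine (GCov.of_ax (LowerThy.R3 b U₀ hbU)).mono ?_
  rintro _ ⟨c, hc, rfl⟩
  exact ⟨c, hU₀ hc, rfl⟩

theorem exists_cov_of_lowerCov (hbc : IsBasicCover cov) {w : S → Set S}
    (hw : IsContinuous cov w) {A : Finset S} {𝒰 : Set (Finset S)} (h : lowerCov cov A 𝒰)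
    {E : Set S} (hE : ∀ B ∈ 𝒰, ∃ b ∈ B, cov b E) : ∃ a ∈ A, cov a E := by
  induction h with
  | refl hA => exact hE _ hA
  | le hBA _ ih =>
    obtain ⟨b, hb, hbE⟩ := ih hE
    exact ⟨b, hBA hb, hbE⟩
  | ax C hT _ ih =>
    by_contra! hcon
    have key : ∀ b : S, (∃ x ∈ C ∪ {b}, cov x E) → cov b E := by
      rintro b ⟨x, hx, hxE⟩
      rcases Finset.mem_union.1 hx with hx | hx
      · exact absurd hxE (hcon x (Finset.mem_union_left _ hx))
      · rwa [← Finset.mem_singleton.1 hx]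
    cases hT with
    | R3 a F hF =>
      exact hcon a (by simp) (hbc.2 _ _ _ hF fun b hb => key b (ih _ ⟨b, hb, rfl⟩ hE))
    | R4 a =>
      exact hcon a (by simp) (hbc.2 _ _ _ (hw.2 a) fun b hb =>
        key b (ih _ ⟨b, hw.1 a b hb, rfl⟩ hE))

theorem lowerCov_sgl_iff (hbc : IsBasicCover cov) {w : S → Set S} (hw : IsContinuous cov w)
    {A E : Finset S} : lowerCov cov A ↑(sgl E) ↔ ∃ a ∈ A, cov a ↑E := by
  constructor
  · refine fun h => exists_cov_of_lowerCov hbc hw h fun B hB => ?_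
    obtain ⟨e, he, rfl⟩ := mem_sgl.1 hB
    exact ⟨e, by simp, hbc.1 _ _ he⟩
  · rintro ⟨a, ha, haE⟩
    rw [coe_sgl]
    exact GCov.le (by simpa using ha) (lowerCov_of_cov haE)

theorem Below.wb (hbc : IsBasicCover cov) {w : S → Set S} (hw : IsContinuous cov w)
    {A B : Finset S} (h : Below cov A B) : wb (lowerCov cov) A B := by
  intro 𝒰 hB
  induction hB generalizing A with
  | @refl B 𝒰 hB =>
    refine ⟨{B}, by simpa using hB, ?_⟩
    rw [Finset.coe_singleton]
    refine GCov.singleton_of_forall fun b hb => ?_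
    obtain ⟨a, ha, hab⟩ := h b hb
    refine GCov.le (Finset.singleton_subset_iff.2 ha) ((lowerCov_of_cov
      (cov_of_wb hbc hab)).mono ?_)
    rintro _ ⟨_, rfl, rfl⟩
    rfl
  | le hBA _ ih => exact ih fun b hb => h b (hBA hb)
  | @ax B 𝒞 𝒰 C hT _ ih =>
    obtain ⟨b, U, hb, hbU, hU⟩ : ∃ b U, b ∈ B ∧ cov b U ∧ ∀ u ∈ U, {u} ∈ 𝒞 := by
      cases hT with
      | R3 a F hF => exact ⟨a, F, by simp, hF, fun u hu => ⟨u, hu, rfl⟩⟩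
      | R4 a => exact ⟨a, w a, by simp, hw.2 a, fun u hu => ⟨u, hw.1 a u hu, rfl⟩⟩
    obtain ⟨a, ha, hab⟩ := h b (Finset.mem_union_right _ hb)
    have : wbS cov {a} U := fun W hW => by
      obtain ⟨W₀, hW₀, h₀⟩ := hab W (hbc.2 _ _ _ hbU hW)
      exact ⟨W₀, hW₀, by rintro _ rfl; exact h₀⟩
    obtain ⟨G, haG, hG⟩ := exists_finset_cov_wb hbc hw this
    obtain ⟨𝒰₀, h𝒰₀, h₀⟩ := exists_finset_subset_forall (U := 𝒰)
      (p := fun g F => lowerCov cov (A ∪ {g}) ↑F) (G := G)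
      (fun _ _ _ hF h => GCov.mono h (by exact_mod_cast hF)) (by
        intro g hg
        obtain ⟨u, hu, hgu⟩ := hG g hg
        refine ih _ (hU u hu) fun x hx => ?_
        rcases Finset.mem_union.1 hx with hx | hx
        · obtain ⟨y, hy, hyx⟩ := h x (Finset.mem_union_left _ hx)
          exact ⟨y, Finset.mem_union_left _ hy, hyx⟩
        · exact ⟨g, by simp, by rwa [Finset.mem_singleton.1 hx]⟩)
    refine ⟨𝒰₀, h𝒰₀, (lowerCov_of_cov (haG a rfl)).cut (by simpa using ha) ?_⟩
    rintro _ ⟨g, hg, rfl⟩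
    exact h₀ g hg

theorem lowerCov_below (B : Finset S) : lowerCov cov B {A | Below cov A B} := by
  induction B using Finset.induction_on with
  | empty => exact GCov.refl fun b hb => absurd hb (Finset.notMem_empty b)
  | insert b B _ ih =>
    refine (GCov.of_ax (LowerThy.R4 b)).cut (by simp) ?_
    rintro _ ⟨a, hab, rfl⟩
    refine ih.cut ((Finset.subset_insert b B).trans Finset.subset_union_left) fun A hA => ?_
    refine GCov.refl fun x hx => ?_
    rcases Finset.mem_insert.1 hx with rfl | hx
    · exact ⟨a, by simp, hab⟩
    · obtain ⟨y, hy, hyx⟩ := hA x hx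
      exact ⟨y, Finset.mem_union_right _ hy, hyx⟩

theorem exists_finset_below_of_wbS {𝒜 𝒞 : Set (Finset S)} (h : wbS (lowerCov cov) 𝒜 𝒞) :
    ∃ 𝒟 : Finset (Finset S), covS (lowerCov cov) 𝒜 ↑𝒟 ∧ ∀ D ∈ 𝒟, ∃ C ∈ 𝒞, Below cov D C := by
  obtain ⟨𝒟, h𝒟, h𝒜⟩ := h {D | ∃ C ∈ 𝒞, Below cov D C} fun C hC =>
    (lowerCov_below C).mono fun D hD => ⟨C, hC, hD⟩
  exact ⟨𝒟, h𝒜, fun D hD => h𝒟 hD⟩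

theorem wbS_sgl_iff (hbc : IsBasicCover cov) {w : S → Set S} (hw : IsContinuous cov w)
    {A C : Finset S} :
    wbS (lowerCov cov) ↑(sgl A) ↑(sgl C) ↔ wbS cov ↑A ↑C := by
  constructor
  · intro h W hW
    obtain ⟨𝒲, h𝒲, h'⟩ := h {B | ∃ b ∈ W, B = {b}} (by
      rintro B hB
      obtain ⟨c, hc, rfl⟩ := mem_sgl.1 hB
      exact lowerCov_of_cov (hW c hc))
    obtain ⟨W₀, hW₀, h₀⟩ := exists_finset_subset_forall (U := W)
      (p := fun B F => ∃ b ∈ B, b ∈ F) (G := 𝒲)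
      (fun _ _ _ hF ⟨b, hb, hbF⟩ => ⟨b, hb, hF hbF⟩) (by
        intro B hB
        obtain ⟨b, hb, rfl⟩ := h𝒲 hB
        exact ⟨{b}, by simpa using hb, b, by simp, by simp⟩)
    refine ⟨W₀, hW₀, fun a ha => ?_⟩
    obtain ⟨x, hx, hxW⟩ := exists_cov_of_lowerCov hbc hw (E := ↑W₀)
      (h' {a} (mem_sgl.2 ⟨a, ha, rfl⟩)) fun B hB => by
        obtain ⟨b, hb, hbW⟩ := h₀ B hB
        exact ⟨b, hb, hbc.1 _ _ hbW⟩
    rwa [← Finset.mem_singleton.1 hx]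
  · intro h 𝒲 h𝒲
    obtain ⟨G, hAG, hG⟩ := exists_finset_cov_wb hbc hw h
    obtain ⟨𝒲₀, h𝒲₀, h₀⟩ := exists_finset_subset_forall (U := 𝒲)
      (p := fun g F => lowerCov cov {g} ↑F) (G := G)
      (fun _ _ _ hF h => GCov.mono h (by exact_mod_cast hF)) (by
        intro g hg
        obtain ⟨c, hc, hgc⟩ := hG g hg
        exact Below.wb hbc hw (A := {g}) (B := {c}) (by simpa [Below] using hgc) 𝒲
          (h𝒲 _ (mem_sgl.2 ⟨c, hc, rfl⟩)))
    refine ⟨𝒲₀, h𝒲₀, fun B hB => ?_⟩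
    obtain ⟨a, ha, rfl⟩ := mem_sgl.1 hB
    refine GCov_trans (lowerCov_of_cov (hAG a ha)) ?_
    rintro _ ⟨g, hg, rfl⟩
    exact h₀ g hg

end Lower

section Transversal

variable {S P : Type*} {cov : S → Set S → Prop} {T : Finset P → Set (Finset P) → Prop}
  {ρ : S → P} {lam : Finset S → P}

theorem GCov_loc_below (hloc : ∀ a b, wb cov a b → GCov T ∅ {{lam {a}}, {ρ b}})
    {C D : Finset S} (h : Below cov D C) :
    GCov T ∅ {Y | Y = C.image ρ ∨ ∃ d ∈ D, Y = {lam {d}}} := by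
  induction C using Finset.induction_on with
  | empty => exact GCov.refl (Or.inl rfl)
  | insert c C _ ih =>
    obtain ⟨d, hd, hdc⟩ := h c (Finset.mem_insert_self c C)
    refine (hloc d c hdc).cut subset_rfl ?_
    rintro _ (rfl | rfl)
    · exact GCov.of_subset (Or.inr ⟨d, hd, rfl⟩) Finset.subset_union_right
    · refine (ih fun x hx => h x (Finset.mem_insert_of_mem hx)).cut (Finset.empty_subset _) ?_
      rintro _ (rfl | ⟨d', hd', rfl⟩)
      · refine GCov.of_subset (Or.inl rfl) ?_
        rw [Finset.image_insert, Finset.insert_eq]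
        exact Finset.union_subset_union_left Finset.subset_union_right
      · exact GCov.of_subset (Or.inr ⟨d', hd', rfl⟩) Finset.subset_union_right

/-- Finitely many applications of locatedness: either some member of `𝒞` holds, or some
transversal of `𝒟` is refuted. -/
theorem GCov_transversal (h0 : GCov T ∅ {{lam ∅}})
    (hU : ∀ A B, GCov T {lam A, lam B} {{lam (A ∪ B)}})
    (hloc : ∀ a b, wb cov a b → GCov T ∅ {{lam {a}}, {ρ b}})
    {𝒟 : Finset (Finset S)} {𝒞 : Set (Finset S)} (h : ∀ D ∈ 𝒟, ∃ C ∈ 𝒞, Below cov D C) :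
    GCov T ∅ {Y | (∃ C ∈ 𝒞, Y = C.image ρ) ∨
      ∃ E : Finset S, (∀ D ∈ 𝒟, ∃ d ∈ D, d ∈ E) ∧ Y = {lam E}} := by
  induction 𝒟 using Finset.induction_on with
  | empty => exact h0.mono (by rintro _ rfl; exact Or.inr ⟨∅, by simp, rfl⟩)
  | insert D 𝒟 _ ih =>
    obtain ⟨C, hC, hDC⟩ := h D (Finset.mem_insert_self D 𝒟)
    refine (GCov_loc_below hloc hDC).cut subset_rfl ?_
    rintro _ (rfl | ⟨d, hd, rfl⟩)
    · exact GCov.of_subset (Or.inl ⟨C, hC, rfl⟩) Finset.subset_union_right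
    · refine (ih fun x hx => h x (Finset.mem_insert_of_mem hx)).cut (Finset.empty_subset _) ?_
      rintro _ (⟨C', hC', rfl⟩ | ⟨E, hE, rfl⟩)
      · exact GCov.of_subset (Or.inl ⟨C', hC', rfl⟩) Finset.subset_union_right
      · refine GCov.le ?_ ((hU {d} E).mono ?_)
        · rw [Finset.insert_eq]
          exact Finset.union_subset_union_left Finset.subset_union_right
        · rintro _ rfl
          refine Or.inr ⟨_, fun D' hD' => ?_, rfl⟩
          rcases Finset.mem_insert.1 hD' with rfl | hD'
          · exact ⟨d, hd, by simp⟩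
          · obtain ⟨x, hx, hxE⟩ := hE D' hD'
            exact ⟨x, hx, Finset.mem_union_right _ hxE⟩

end Transversal

section Lawson

variable {S : Type*} {cov : S → Set S → Prop}

theorem lawsonCov_r {a : S} {U : Set S} (h : cov a U) :
    lawsonCov cov {PatchGen.r a} {Y | ∃ b ∈ U, Y = {PatchGen.r b}} := by
  refine GCov_trans (GCov.of_ax (LawsonThy.R4 a)) ?_
  rintro _ ⟨b, hb, rfl⟩
  obtain ⟨U₀, hU₀, hbU⟩ := hb U h
  refine (GCov.of_ax (LawsonThy.R3 b U₀ hbU)).mono ?_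
  rintro _ ⟨c, hc, rfl⟩
  exact ⟨c, hU₀ hc, rfl⟩

theorem lawsonCov_l_union (hbc : IsBasicCover cov) {A B C : Finset S}
    (hC : ∀ c ∈ C, c ∈ A ∨ c ∈ B) :
    lawsonCov cov {PatchGen.l A, PatchGen.l B} {{PatchGen.l C}} := by
  refine GCov_trans (GCov.of_ax (LawsonThy.L3 A B)) ?_
  rintro _ ⟨D, hA, hB, rfl⟩
  exact GCov.of_ax (LawsonThy.L2 C D fun c hc =>
    (hC c hc).elim (covS_of_wbS hbc hA c) (covS_of_wbS hbc hB c))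

theorem lawsonCov_image_r {A : Finset S} {𝒰 : Set (Finset S)} (h : lowerCov cov A 𝒰) :
    lawsonCov cov (A.image PatchGen.r) {Y | ∃ B ∈ 𝒰, Y = B.image PatchGen.r} := by
  refine GCov.image (fun A 𝒞 hT => ?_) h
  cases hT with
  | R3 a A hA =>
    refine (GCov.of_ax (LawsonThy.R3 a A hA)).mono ?_
    rintro _ ⟨b, hb, rfl⟩
    exact ⟨{b}, ⟨b, hb, rfl⟩, by simp⟩
  | R4 a =>
    refine (GCov.of_ax (LawsonThy.R4 a)).mono ?_
    rintro _ ⟨b, hb, rfl⟩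
    exact ⟨{b}, ⟨b, hb, rfl⟩, by simp⟩

theorem lawsonCov.patchCov {A : Finset (PatchGen S)} {𝒰 : Set (Finset (PatchGen S))}
    (h : lawsonCov cov A 𝒰) (le : S → S → Prop) : patchCov cov le A 𝒰 := by
  refine GCov.mono_theory (fun A 𝒞 hT => ?_) h
  cases hT with
  | R3 a A hA => exact PatchThy.R3 a A hA
  | R4 a => exact PatchThy.R4 a
  | L1 => exact PatchThy.L1
  | L2 A B hAB => exact PatchThy.L2 A B hAB
  | L3 A B => exact PatchThy.L3 A B
  | Loc a b hab => exact PatchThy.Loc a b hab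
  | D a => exact PatchThy.D a

end Lawson

section LawsonPatch

variable {S : Type*} {cov : S → Set S → Prop}

/-- `C` covers some element of each member of `𝒜`. -/
def CovTransversal (cov : S → Set S → Prop) (𝒜 : Finset (Finset S)) (C : Finset S) : Prop :=
  ∀ A ∈ 𝒜, ∃ a ∈ A, cov a ↑C

theorem covTransversal_iff (hbc : IsBasicCover cov) {w : S → Set S} (hw : IsContinuous cov w)
    {𝒜 : Finset (Finset S)} {C : Finset S} :
    CovTransversal cov 𝒜 C ↔ covS (lowerCov cov) ↑𝒜 ↑(sgl C) :=
  forall₂_congr fun _ _ => (lowerCov_sgl_iff hbc hw).symm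

theorem patchCov_r_image (A : Finset S) :
    patchCov (lowerCov cov) supord (A.image fun a => PatchGen.r {a}) {{PatchGen.r A}} := by
  induction A using Finset.induction_on with
  | empty =>
    refine GCov_trans (GCov.of_ax PatchThy.R1) ?_
    rintro _ ⟨A, rfl⟩
    refine ((lawsonCov_r (cov := lowerCov cov) (U := {∅})
      (GCov.of_subset rfl (Finset.empty_subset _))).patchCov supord).mono ?_
    rintro _ ⟨_, rfl, rfl⟩
    rfl
  | insert a A _ ih =>
    refine ih.cut (by simp [Finset.image_insert]) ?_
    rintro _ rfl
    refine (GCov.of_ax (PatchThy.R2 {a} A)).cut ?_ ?_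
    · simp [Finset.insert_subset_iff]
    · rintro _ ⟨B, ⟨A₁, h₁, A₂, h₂, haB, hAB⟩, rfl⟩
      obtain rfl : A₁ = {a} := h₁
      obtain rfl : A = A₂ := h₂.symm
      refine GCov.le Finset.subset_union_right (((lawsonCov_r (cov := lowerCov cov)
        (U := {insert a A}) (GCov.of_subset rfl ?_)).patchCov supord).mono ?_)
      · exact Finset.insert_subset (haB (by simp)) hAB
      · rintro _ ⟨_, rfl, rfl⟩
        rfl

theorem patchCov_l_covTransversal (hbc : IsBasicCover cov) {w : S → Set S}
    (hw : IsContinuous cov w) (𝒜 : Finset (Finset S)) :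
    patchCov (lowerCov cov) supord {PatchGen.l 𝒜}
      {Y | ∃ C, CovTransversal cov 𝒜 C ∧ Y = {PatchGen.l (sgl C)}} := by
  have hL : IsBasicCover (lowerCov cov) := GCov_isBasicCover _
  refine (GCov.of_ax (PatchThy.L3 𝒜 𝒜)).cut (by simp) ?_
  rintro _ ⟨𝒞, h𝒞, -, rfl⟩
  obtain ⟨𝒟, h𝒜𝒟, h𝒟⟩ := exists_finset_below_of_wbS h𝒞
  refine (GCov_transversal (cov := cov) (ρ := fun a => PatchGen.r {a})
    (lam := fun A => PatchGen.l (sgl A)) ?_ ?_ ?_ h𝒟).cut (Finset.empty_subset _) ?_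
  · exact GCov.of_ax PatchThy.L1
  · refine fun A B => (lawsonCov_l_union hL fun x hx => ?_).patchCov supord
    obtain ⟨c, hc, rfl⟩ := mem_sgl.1 hx
    exact (Finset.mem_union.1 hc).imp (fun h => mem_sgl.2 ⟨c, h, rfl⟩)
      fun h => mem_sgl.2 ⟨c, h, rfl⟩
  · exact fun a b hab => GCov.of_ax
      (PatchThy.Loc {a} {b} (Below.wb hbc hw (by simpa [Below] using hab)))
  · rintro _ (⟨C, hC, rfl⟩ | ⟨E, hE, rfl⟩)
    · refine (patchCov_r_image C).cut Finset.subset_union_right ?_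
      rintro _ rfl
      refine (GCov.of_ax (PatchThy.L2 {C} 𝒞 fun B hB => ?_)).cut (by simp) ?_
      · exact hL.1 _ _ (by rw [Finset.mem_singleton.1 hB]; exact hC)
      · rintro _ rfl
        refine (GCov.of_ax (PatchThy.D C)).cut (by simp [Finset.insert_subset_iff]) ?_
        rintro _ ⟨⟩
    · refine GCov.of_subset ⟨E, fun A hA => ?_, rfl⟩ Finset.subset_union_right
      refine exists_cov_of_lowerCov hbc hw (h𝒜𝒟 A hA) fun D hD => ?_
      obtain ⟨d, hd, hdE⟩ := hE D hD
      exact ⟨d, hd, hbc.1 _ _ hdE⟩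

/-- Interpretation of the generators of `Patch(Lower(S))` in `L(S)`. -/
def patchLowerToLawson (cov : S → Set S → Prop) :
    PatchGen (Finset S) → Set (Finset (PatchGen S))
  | PatchGen.r A => {A.image PatchGen.r}
  | PatchGen.l 𝒜 => {Y | ∃ C, CovTransversal cov 𝒜 C ∧ Y = {PatchGen.l C}}

/-- Interpretation of the generators of `L(S)` in `Patch(Lower(S))`. -/
def lawsonToPatchLower : PatchGen S → Set (Finset (PatchGen (Finset S)))
  | PatchGen.r a => {{PatchGen.r {a}}}
  | PatchGen.l A => {{PatchGen.l (sgl A)}}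

theorem patchLowerToLawson_sound (hbc : IsBasicCover cov) {w : S → Set S}
    (hw : IsContinuous cov w) {A : Finset (PatchGen (Finset S))}
    {𝒞 : Set (Finset (PatchGen (Finset S)))} (hT : PatchThy (lowerCov cov) supord A 𝒞)
    {X : Finset (PatchGen S)} (hX : interp (LawsonThy cov) (patchLowerToLawson cov) X A) :
    lawsonCov cov X (rinv (interp (LawsonThy cov) (patchLowerToLawson cov)) 𝒞) := by
  cases hT with
  | R1 => exact GCov.refl ⟨_, ⟨∅, rfl⟩, interp_of_mem rfl (by simp)⟩
  | R2 A B =>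
    refine (hX (PatchGen.r A) (by simp)).cut subset_rfl ?_
    rintro _ rfl
    refine (hX (PatchGen.r B) (by simp)).cut Finset.subset_union_left ?_
    rintro _ rfl
    refine GCov.refl ⟨_, ⟨A ∪ B, ⟨_, rfl, _, rfl, Finset.subset_union_left,
      Finset.subset_union_right⟩, rfl⟩, interp_of_mem rfl ?_⟩
    rw [Finset.image_union]
    exact Finset.union_subset_union_left Finset.subset_union_right
  | R3 A 𝒰 hA =>
    refine (hX (PatchGen.r A) (by simp)).cut subset_rfl ?_
    rintro _ rfl
    refine (lawsonCov_image_r hA).cut Finset.subset_union_right ?_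
    rintro _ ⟨B, hB, rfl⟩
    exact GCov.refl ⟨_, ⟨B, hB, rfl⟩, interp_of_mem rfl Finset.subset_union_right⟩
  | R4 A =>
    refine (hX (PatchGen.r A) (by simp)).cut subset_rfl ?_
    rintro _ rfl
    refine (lawsonCov_image_r (lowerCov_below A)).cut Finset.subset_union_right ?_
    rintro _ ⟨B, hB, rfl⟩
    exact GCov.refl ⟨_, ⟨B, Below.wb hbc hw hB, rfl⟩,
      interp_of_mem rfl Finset.subset_union_right⟩
  | L1 =>
    refine (GCov.of_ax LawsonThy.L1).cut (Finset.empty_subset _) ?_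
    rintro _ rfl
    exact GCov.refl ⟨_, rfl, interp_of_mem ⟨∅, by simp [CovTransversal], rfl⟩
      Finset.subset_union_right⟩
  | L2 𝒜 ℬ h =>
    refine (hX (PatchGen.l ℬ) (by simp)).cut subset_rfl ?_
    rintro _ ⟨C, hC, rfl⟩
    exact GCov.refl ⟨_, rfl, interp_of_mem
      ⟨C, fun A hA => exists_cov_of_lowerCov hbc hw (h A hA) hC, rfl⟩
      Finset.subset_union_right⟩
  | L3 𝒜 ℬ =>
    refine (hX (PatchGen.l 𝒜) (by simp)).cut subset_rfl ?_
    rintro _ ⟨C, hC, rfl⟩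
    refine (hX (PatchGen.l ℬ) (by simp)).cut Finset.subset_union_left ?_
    rintro _ ⟨D, hD, rfl⟩
    refine (GCov.of_ax (LawsonThy.L3 C D)).cut ?_ ?_
    · simp [Finset.insert_subset_iff]
    · rintro _ ⟨E, hCE, hDE, rfl⟩
      have key : ∀ {𝒜 : Finset (Finset S)} {C : Finset S}, CovTransversal cov 𝒜 C →
          wbS cov ↑C ↑E → wbS (lowerCov cov) ↑𝒜 ↑(sgl E) := by
        intro 𝒜 C h𝒜 hCE 𝒲 h𝒲
        obtain ⟨𝒲₀, h𝒲₀, h₀⟩ := (wbS_sgl_iff hbc hw).2 hCE 𝒲 h𝒲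
        exact ⟨𝒲₀, h𝒲₀, fun A hA =>
          GCov_trans ((covTransversal_iff hbc hw).1 h𝒜 A hA) h₀⟩
      exact GCov.refl ⟨_, ⟨sgl E, key hC hCE, key hD hDE, rfl⟩, interp_of_mem
        ⟨E, (covTransversal_iff hbc hw).2 fun A hA => GCov.refl hA, rfl⟩
        Finset.subset_union_right⟩
  | Loc A B h =>
    obtain ⟨𝒟, hA𝒟, h𝒟⟩ := exists_finset_below_of_wbS (𝒜 := {A}) (𝒞 := {B}) (by
      intro 𝒲 h𝒲
      obtain ⟨𝒲₀, h𝒲₀, h₀⟩ := h 𝒲 (h𝒲 B rfl)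
      exact ⟨𝒲₀, h𝒲₀, by rintro _ rfl; exact h₀⟩)
    refine (GCov_transversal (cov := cov) (ρ := PatchGen.r) (lam := PatchGen.l)
      (GCov.of_ax LawsonThy.L1) ?_ ?_ h𝒟).cut (Finset.empty_subset _) ?_
    · exact fun A B => lawsonCov_l_union hbc fun c hc => Finset.mem_union.1 hc
    · exact fun a b hab => GCov.of_ax (LawsonThy.Loc a b hab)
    · rintro _ (⟨C, rfl, rfl⟩ | ⟨E, hE, rfl⟩)
      · exact GCov.refl ⟨_, Or.inr rfl, interp_of_mem rfl Finset.subset_union_right⟩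
      · refine GCov.refl ⟨_, Or.inl rfl, interp_of_mem ⟨E, fun A' hA' => ?_, rfl⟩
          Finset.subset_union_right⟩
        rw [Finset.mem_singleton.1 hA']
        refine exists_cov_of_lowerCov hbc hw (hA𝒟 A rfl) fun D hD => ?_
        obtain ⟨d, hd, hdE⟩ := hE D hD
        exact ⟨d, hd, hbc.1 _ _ hdE⟩
  | D A =>
    refine (hX (PatchGen.l {A}) (by simp)).cut subset_rfl ?_
    rintro _ ⟨C, hC, rfl⟩
    refine (hX (PatchGen.r A) (by simp)).cut Finset.subset_union_left ?_
    rintro _ rfl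
    obtain ⟨a, ha, haC⟩ := hC A (by simp)
    refine (GCov.of_ax (LawsonThy.L2 {a} C (by simpa [covS] using haC))).cut ?_ ?_
    · simp
    · rintro _ rfl
      refine (GCov.of_ax (LawsonThy.D a)).cut ?_ ?_
      · simp [Finset.insert_subset_iff, ha]
      · rintro _ ⟨⟩

theorem lawsonToPatchLower_sound (hbc : IsBasicCover cov) {w : S → Set S}
    (hw : IsContinuous cov w) {A : Finset (PatchGen S)} {𝒞 : Set (Finset (PatchGen S))}
    (hT : LawsonThy cov A 𝒞) {X : Finset (PatchGen (Finset S))}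
    (hX : interp (PatchThy (lowerCov cov) supord) lawsonToPatchLower X A) :
    patchCov (lowerCov cov) supord X
      (rinv (interp (PatchThy (lowerCov cov) supord) lawsonToPatchLower) 𝒞) := by
  have hr : ∀ {a : S} {U : Set S}, cov a U → ∀ {Z : Finset (PatchGen (Finset S))},
      PatchGen.r {a} ∈ Z → patchCov (lowerCov cov) supord Z (rinv (interp
        (PatchThy (lowerCov cov) supord) lawsonToPatchLower) {B | ∃ b ∈ U, B = {PatchGen.r b}}) := by
    intro a U h Z hZ
    refine ((lawsonCov_r (lowerCov_of_cov h)).patchCov supord).cut (by simpa using hZ) ?_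
    rintro _ ⟨_, ⟨b, hb, rfl⟩, rfl⟩
    exact GCov.refl ⟨_, ⟨b, hb, rfl⟩, interp_of_mem rfl Finset.subset_union_right⟩
  cases hT with
  | R3 a U hU =>
    refine (hX (PatchGen.r a) (by simp)).cut subset_rfl ?_
    rintro _ rfl
    exact hr hU (by simp)
  | R4 a =>
    refine (hX (PatchGen.r a) (by simp)).cut subset_rfl ?_
    rintro _ rfl
    exact hr (U := {b | wb cov b a}) (hbc.2 _ _ _ (hw.2 a) fun b hb => hbc.1 _ _ (hw.1 a b hb))
      (by simp)
  | L1 =>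
    refine (GCov.of_ax PatchThy.L1).cut (Finset.empty_subset _) ?_
    rintro _ rfl
    exact GCov.refl ⟨_, rfl, interp_of_mem rfl Finset.subset_union_right⟩
  | L2 A B h =>
    refine (hX (PatchGen.l B) (by simp)).cut subset_rfl ?_
    rintro _ rfl
    refine (GCov.of_ax (PatchThy.L2 (sgl A) (sgl B) fun C hC => ?_)).cut
      Finset.subset_union_right ?_
    · obtain ⟨a, ha, rfl⟩ := mem_sgl.1 hC
      exact (lowerCov_sgl_iff hbc hw).2 ⟨a, by simp, h a ha⟩
    · rintro _ rfl
      exact GCov.refl ⟨_, rfl, interp_of_mem rfl Finset.subset_union_right⟩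
  | L3 A B =>
    refine (hX (PatchGen.l A) (by simp)).cut subset_rfl ?_
    rintro _ rfl
    refine (hX (PatchGen.l B) (by simp)).cut Finset.subset_union_left ?_
    rintro _ rfl
    refine (GCov.of_ax (PatchThy.L3 (sgl A) (sgl B))).cut ?_ ?_
    · simp [Finset.insert_subset_iff]
    · rintro _ ⟨𝒞, hA𝒞, hB𝒞, rfl⟩
      refine (patchCov_l_covTransversal hbc hw 𝒞).cut Finset.subset_union_right ?_
      rintro _ ⟨C, hC, rfl⟩
      have key : ∀ {A : Finset S}, wbS (lowerCov cov) ↑(sgl A) ↑𝒞 → wbS cov ↑A ↑C :=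
        fun h => (wbS_sgl_iff hbc hw).1 fun 𝒲 h𝒲 => h 𝒲 fun D hD =>
          GCov_trans ((covTransversal_iff hbc hw).1 hC D hD) h𝒲
      exact GCov.refl ⟨_, ⟨C, key hA𝒞, key hB𝒞, rfl⟩,
        interp_of_mem rfl Finset.subset_union_right⟩
  | Loc a b hab =>
    refine (GCov.of_ax (PatchThy.Loc {a} {b}
      (Below.wb hbc hw (by simpa [Below] using hab)))).cut (Finset.empty_subset _) ?_
    rintro _ (rfl | rfl)
    · exact GCov.refl ⟨_, Or.inl rfl, interp_of_mem rfl Finset.subset_union_right⟩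
    · exact GCov.refl ⟨_, Or.inr rfl, interp_of_mem rfl Finset.subset_union_right⟩
  | D a =>
    refine (hX (PatchGen.l {a}) (by simp)).cut subset_rfl ?_
    rintro _ rfl
    refine (hX (PatchGen.r a) (by simp)).cut Finset.subset_union_left ?_
    rintro _ rfl
    refine (GCov.of_ax (PatchThy.D {a})).cut ?_ ?_
    · simp [Finset.insert_subset_iff, sgl]
    · rintro _ ⟨⟩

theorem lawson_mapEq_id (hbc : IsBasicCover cov) {w : S → Set S} (hw : IsContinuous cov w) :
    MapEq (lawsonCov cov)
      (comp (interp (PatchThy (lowerCov cov) supord) lawsonToPatchLower)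
        (interp (LawsonThy cov) (patchLowerToLawson cov))) (fun A B => A = B) := by
  refine comp_interp_mapEq_id (fun _ _ hT _ hX => patchLowerToLawson_sound hbc hw hT hX) ?_ ?_
  · rintro (a | A) _ rfl Y hY
    · simpa [patchLowerToLawson] using interp_singleton.1 hY
    · refine GCov_trans (interp_singleton.1 hY) ?_
      rintro _ ⟨C, hC, rfl⟩
      refine GCov.of_ax (LawsonThy.L2 A C fun a ha => ?_)
      obtain ⟨x, hx, hxC⟩ := hC {a} (mem_sgl.2 ⟨a, ha, rfl⟩)
      rwa [← Finset.mem_singleton.1 hx]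
  · rintro (a | A)
    · exact GCov.refl ⟨_, rfl, interp_of_mem rfl (by simp)⟩
    · exact GCov.refl ⟨_, rfl, interp_of_mem
        ⟨A, (covTransversal_iff hbc hw).2 fun A hA => GCov.refl hA, rfl⟩ subset_rfl⟩

theorem patchLower_mapEq_id (hbc : IsBasicCover cov) {w : S → Set S} (hw : IsContinuous cov w) :
    MapEq (patchCov (lowerCov cov) supord)
      (comp (interp (LawsonThy cov) (patchLowerToLawson cov))
        (interp (PatchThy (lowerCov cov) supord) lawsonToPatchLower)) (fun A B => A = B) := by
  refine comp_interp_mapEq_id (fun _ _ hT _ hX => lawsonToPatchLower_sound hbc hw hT hX) ?_ ?_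
  · rintro (A | 𝒜) _ hC Y hY
    · obtain rfl := hC
      refine GCov_trans (GCov.singleton_of_forall fun g hg => ?_) fun _ hB =>
        hB ▸ patchCov_r_image A
      obtain ⟨a, ha, rfl⟩ := Finset.mem_image.1 hg
      exact hY (PatchGen.r a) (Finset.mem_image_of_mem _ ha)
    · obtain ⟨C, hC, rfl⟩ := hC
      refine GCov_trans (interp_singleton.1 hY) ?_
      rintro _ rfl
      exact GCov.of_ax (PatchThy.L2 𝒜 (sgl C) ((covTransversal_iff hbc hw).1 hC))
  · rintro (A | 𝒜)
    · refine GCov.refl ⟨_, rfl, fun g hg => ?_⟩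
      obtain ⟨a, ha, rfl⟩ := Finset.mem_image.1 hg
      refine ((lawsonCov_r (cov := lowerCov cov) (U := {{a}})
        (GCov.of_subset rfl (by simpa using ha))).patchCov supord).mono ?_
      rintro _ ⟨_, rfl, rfl⟩
      rfl
    · refine (patchCov_l_covTransversal hbc hw 𝒜).mono ?_
      rintro _ ⟨C, hC, rfl⟩
      exact ⟨_, ⟨C, hC, rfl⟩, interp_of_mem rfl subset_rfl⟩

theorem sigmaL_comp_epsP_mapEq_epsL (hbc : IsBasicCover cov) {w : S → Set S}
    (hw : IsContinuous cov w) :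
    MapEq (lawsonCov cov)
      (comp (sigmaL cov) (comp (epsP (lowerCov cov) supord)
        (interp (LawsonThy cov) (patchLowerToLawson cov)))) (epsL cov) := by
  constructor
  · rintro a X ⟨b, hb, A, ⟨B, hXB, hBA⟩, hA⟩
    obtain rfl : a = b := hb.symm
    refine GCov.refl ⟨a, rfl, ?_⟩
    refine GCov_trans (interp_cov
      (fun _ _ hT _ hX => patchLowerToLawson_sound hbc hw hT hX) hBA hXB) ?_
    rintro Y ⟨_, rfl, hY⟩
    refine GCov_trans (interp_singleton.1 hY) ?_
    rintro _ rfl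
    refine (lawsonCov_image_r hA).mono ?_
    rintro _ ⟨_, rfl, rfl⟩
    simp
  · rintro a X ⟨b, hb, hX⟩
    obtain rfl : a = b := hb.symm
    have hX' : interp (LawsonThy cov) (patchLowerToLawson cov) X {PatchGen.r {a}} := by
      simpa [interp_singleton, patchLowerToLawson] using! hX
    exact GCov.refl ⟨a, rfl, {a}, ⟨_, hX', GCov.refl (Set.mem_singleton _)⟩,
      GCov.refl (Set.mem_singleton _)⟩

end LawsonPatch

/-- For every continuous basic cover `S`, the Lawson topology
`L(S)` is isomorphic to `Patch(Lower(S))`, by the unique formal topology map over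
`S` comparing `ε_L : L(S) → S` with `σ_L : Lower(S) → S`. -/
theorem lawson_iso_patch_lower {S : Type u}
    (cov : S → Set S → Prop) (hbc : IsBasicCover cov)
    (w : S → Set S) (hw : IsContinuous cov w) :
    ∃ (r : Finset (PatchGen S) → Finset (PatchGen (Finset S)) → Prop)
      (s : Finset (PatchGen (Finset S)) → Finset (PatchGen S) → Prop),
      IsFTM (lawsonCov cov) supord (patchCov (lowerCov cov) supord) supord r ∧
      IsFTM (patchCov (lowerCov cov) supord) supord (lawsonCov cov) supord s ∧
      MapEq (lawsonCov cov) (comp s r) (fun A B => A = B) ∧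
      MapEq (patchCov (lowerCov cov) supord) (comp r s) (fun A B => A = B) ∧
      MapEq (lawsonCov cov)
        (comp (sigmaL cov) (comp (epsP (lowerCov cov) supord) r)) (epsL cov) :=
  ⟨_, _, interp_isFTM fun _ _ hT _ hX => patchLowerToLawson_sound hbc hw hT hX,
    interp_isFTM fun _ _ hT _ hX => lawsonToPatchLower_sound hbc hw hT hX,
    lawson_mapEq_id hbc hw, patchLower_mapEq_id hbc hw, sigmaL_comp_epsP_mapEq_epsL hbc hw⟩

end FTP
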